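/- arXiv:1602.04148 — 2 statements merged into one kernel-verified Lean document; each statement's English description precedes it below -/
import Mathlib

section
/- Let F : ℝ² → ℝ be a C¹ function satisfying hypotheses (F+), (F0) and (F∞), and let α, β > 0. Then the function (s,t) ↦ |s·F_s(s,t) + t·F_t(s,t)|/(αs² + βt²) is bounded above on ℝ² \ {(0,0)}; in particular the supremum defining S_F is finite. -/
/-- A continuous function on the plane that is `o(|s| + |t|)` both at the origin and at infinity
is bounded by a multiple of `|s| + |t|` away from the origin. -/
theorem exists_abs_le_mul_of_tendsto_div {G : ℝ × ℝ → ℝ} (hG : Continuous G)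
    (h0 : Filter.Tendsto (fun p : ℝ × ℝ => G p / (|p.1| + |p.2|))
      (nhdsWithin ((0, 0) : ℝ × ℝ) {((0, 0) : ℝ × ℝ)}ᶜ) (nhds 0))
    (hInf : Filter.Tendsto (fun p : ℝ × ℝ => G p / (|p.1| + |p.2|))
      (Filter.comap (fun p : ℝ × ℝ => |p.1| + |p.2|) Filter.atTop) (nhds 0)) :
    ∃ M : ℝ, 0 ≤ M ∧ ∀ p : ℝ × ℝ, p ≠ (0, 0) → |G p| ≤ M * (|p.1| + |p.2|) := by
  have hsmall : ∀ᶠ x in nhds (0 : ℝ), |x| < 1 :=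
    continuous_abs.continuousAt.eventually_lt_const (by simp)
  obtain ⟨δ, hδ, hδ'⟩ := Metric.mem_nhdsWithin_iff.1 (h0.eventually hsmall)
  obtain ⟨R, hR⟩ := Filter.eventually_atTop.1
    (Filter.eventually_comap.1 (hInf.eventually hsmall))
  obtain ⟨K, hK⟩ := (isCompact_closedBall ((0, 0) : ℝ × ℝ) R).exists_bound_of_continuousOn
    hG.continuousOn
  refine ⟨1 + |K| / δ, by positivity, fun p hp => ?_⟩
  have hnorm : ‖p‖ ≤ |p.1| + |p.2| := by
    rw [Prod.norm_def, Real.norm_eq_abs, Real.norm_eq_abs]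
    exact max_le (by linarith [abs_nonneg p.2]) (by linarith [abs_nonneg p.1])
  have hN : 0 < |p.1| + |p.2| := (norm_pos_iff.2 hp).trans_le hnorm
  have hKδ : 0 ≤ |K| / δ := by positivity
  have of_quotient : |G p / (|p.1| + |p.2|)| < 1 →
      |G p| ≤ (1 + |K| / δ) * (|p.1| + |p.2|) := by
    intro h
    rw [abs_div, abs_of_pos hN, div_lt_one hN] at h
    nlinarith [mul_nonneg hKδ hN.le]
  by_cases h1 : ‖p‖ < δ
  · exact of_quotient (hδ' ⟨mem_ball_zero_iff.2 h1, hp⟩)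
  by_cases h2 : R ≤ |p.1| + |p.2|
  · exact of_quotient (hR _ h2 p rfl)
  have hGK : ‖G p‖ ≤ K := hK p (mem_closedBall_iff_norm.2 (by
    change ‖p - 0‖ ≤ R
    rw [sub_zero]
    linarith))
  rw [Real.norm_eq_abs] at hGK
  calc |G p| ≤ |K| / δ * δ := by
        rw [div_mul_cancel₀ _ hδ.ne']
        exact hGK.trans (le_abs_self K)
    _ ≤ |K| / δ * (|p.1| + |p.2|) := by gcongr; linarith
    _ ≤ (1 + |K| / δ) * (|p.1| + |p.2|) := by gcongr; linarith

/-- the quotient defining S_F is bounded above. -/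
theorem stmt_4
    (F Fs Ft : ℝ × ℝ → ℝ)
    (hF : ContDiff ℝ 1 F)
    (hFs : ∀ p : ℝ × ℝ, Fs p = fderiv ℝ F p (1, 0))
    (hFt : ∀ p : ℝ × ℝ, Ft p = fderiv ℝ F p (0, 1))
    (hFpos : ∀ p : ℝ × ℝ, 0 ≤ F p)
    (hF00 : F (0, 0) = 0)
    (hFne : F ≠ 0)
    (hFs0 : Filter.Tendsto (fun p : ℝ × ℝ => Fs p / (|p.1| + |p.2|))
      (nhdsWithin ((0, 0) : ℝ × ℝ) {((0, 0) : ℝ × ℝ)}ᶜ) (nhds 0))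
    (hFt0 : Filter.Tendsto (fun p : ℝ × ℝ => Ft p / (|p.1| + |p.2|))
      (nhdsWithin ((0, 0) : ℝ × ℝ) {((0, 0) : ℝ × ℝ)}ᶜ) (nhds 0))
    (hFsInf : Filter.Tendsto (fun p : ℝ × ℝ => Fs p / (|p.1| + |p.2|))
      (Filter.comap (fun p : ℝ × ℝ => |p.1| + |p.2|) Filter.atTop) (nhds 0))
    (hFtInf : Filter.Tendsto (fun p : ℝ × ℝ => Ft p / (|p.1| + |p.2|))
      (Filter.comap (fun p : ℝ × ℝ => |p.1| + |p.2|) Filter.atTop) (nhds 0))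
    (α β : ℝ) (hα : 0 < α) (hβ : 0 < β)
    :
    ∃ C : ℝ, ∀ p : ℝ × ℝ, p ≠ (0, 0) →
      |p.1 * Fs p + p.2 * Ft p| / (α * p.1 ^ 2 + β * p.2 ^ 2) ≤ C := by
  have hcont : ∀ v : ℝ × ℝ, Continuous fun p => fderiv ℝ F p v := fun v =>
    (hF.continuous_fderiv one_ne_zero).clm_apply continuous_const
  obtain ⟨A, hA, hA'⟩ :=
    exists_abs_le_mul_of_tendsto_div ((funext hFs : Fs = _) ▸ hcont (1, 0)) hFs0 hFsInf
  obtain ⟨B, hB, hB'⟩ :=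
    exists_abs_le_mul_of_tendsto_div ((funext hFt : Ft = _) ▸ hcont (0, 1)) hFt0 hFtInf
  have hm : 0 < min α β := lt_min hα hβ
  refine ⟨2 * (A + B) / min α β, fun p hp => ?_⟩
  have hquad : min α β * (p.1 ^ 2 + p.2 ^ 2) ≤ α * p.1 ^ 2 + β * p.2 ^ 2 := by
    rw [mul_add]
    gcongr
    exacts [min_le_left _ _, min_le_right _ _]
  have hsq : (|p.1| + |p.2|) ^ 2 ≤ 2 * (p.1 ^ 2 + p.2 ^ 2) := by
    rw [← sq_abs p.1, ← sq_abs p.2]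
    exact add_sq_le
  refine div_le_of_le_mul₀ (by positivity) (by positivity) ?_
  calc |p.1 * Fs p + p.2 * Ft p| ≤ |p.1| * |Fs p| + |p.2| * |Ft p| := by
        simpa only [abs_mul] using abs_add_le (p.1 * Fs p) (p.2 * Ft p)
    _ ≤ (|p.1| + |p.2|) * (A * (|p.1| + |p.2|)) + (|p.1| + |p.2|) * (B * (|p.1| + |p.2|)) := by
        gcongr
        · exact le_add_of_nonneg_right (abs_nonneg _)
        · exact hA' p hp
        · exact le_add_of_nonneg_left (abs_nonneg _)
        · exact hB' p hp
    _ = (A + B) * (|p.1| + |p.2|) ^ 2 := by ring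
    _ ≤ (A + B) * (2 * (p.1 ^ 2 + p.2 ^ 2)) := by gcongr
    _ = 2 * (A + B) / min α β * (min α β * (p.1 ^ 2 + p.2 ^ 2)) := by field_simp
    _ ≤ 2 * (A + B) / min α β * (α * p.1 ^ 2 + β * p.2 ^ 2) := by gcongr
end

section
/- Let F : ℝ² → ℝ be a C¹ function satisfying hypotheses (F+), (F0) and (F∞), and let α, β > 0. Then the supremum over (s,t) ≠ (0,0) of F(s,t)/(αs² + βt²) is finite and strictly positive, and it is attained: there exists (s₀,t₀) ≠ (0,0) such that F(s₀,t₀)/(αs₀² + βt₀²) ≥ F(s,t)/(αs² + βt²) for all (s,t) ≠ (0,0). -/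
open Filter Topology Asymptotics

section MeanValue

variable {E : Type*} [NormedAddCommGroup E] [NormedSpace ℝ E] {f : E → ℝ}

theorem norm_le_of_norm_fderiv_le_on_closedBall (hf : Differentiable ℝ f) (h0 : f 0 = 0)
    {C : ℝ} {x : E} (hC : ∀ y, ‖y‖ ≤ ‖x‖ → ‖fderiv ℝ f y‖ ≤ C) : ‖f x‖ ≤ C * ‖x‖ := by
  have h0mem : (0 : E) ∈ Metric.closedBall (0 : E) ‖x‖ := by simp
  have hxmem : x ∈ Metric.closedBall (0 : E) ‖x‖ := by simp
  have h := (convex_closedBall (0 : E) ‖x‖).norm_image_sub_le_of_norm_fderiv_le (𝕜 := ℝ)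
    (fun y _ => hf y) (fun y hy => hC y (mem_closedBall_zero_iff.1 hy)) h0mem hxmem
  simpa [h0] using h

theorem isLittleO_norm_sq_nhds_zero_of_fderiv (hf : Differentiable ℝ f) (h0 : f 0 = 0)
    (h : fderiv ℝ f =o[𝓝 0] (id : E → E)) : f =o[𝓝 0] fun x => ‖x‖ ^ 2 := by
  refine isLittleO_iff.2 fun ε hε => ?_
  obtain ⟨δ, hδ, hball⟩ := Metric.eventually_nhds_iff.1 (isLittleO_iff.1 h hε)
  filter_upwards [Metric.ball_mem_nhds (0 : E) hδ] with x hx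
  have := norm_le_of_norm_fderiv_le_on_closedBall hf h0 (C := ε * ‖x‖) fun y hy =>
    (hball (by simpa using hy.trans_lt (mem_ball_zero_iff.1 hx))).trans
      (mul_le_mul_of_nonneg_left hy hε.le)
  simpa [sq, mul_assoc] using this

theorem isLittleO_norm_sq_cocompact_of_fderiv [ProperSpace E] (hf : ContDiff ℝ 1 f)
    (h0 : f 0 = 0) (h : fderiv ℝ f =o[cocompact E] (id : E → E)) :
    f =o[cocompact E] fun x => ‖x‖ ^ 2 := by
  refine isLittleO_iff.2 fun ε hε => ?_
  obtain ⟨K, hK, hKc⟩ := mem_cocompact.1 (isLittleO_iff.1 h (half_pos hε))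
  obtain ⟨M, hM⟩ := hK.exists_bound_of_continuousOn
    (hf.continuous_fderiv one_ne_zero).continuousOn
  filter_upwards [(tendsto_norm_cocompact_atTop (E := E)).eventually_ge_atTop (|M| / (ε / 2))]
    with x hx
  have hMx : |M| ≤ ε / 2 * ‖x‖ := by
    rwa [div_le_iff₀' (half_pos hε)] at hx
  have := norm_le_of_norm_fderiv_le_on_closedBall (hf.differentiable one_ne_zero) h0
    (C := ε * ‖x‖) (x := x) fun y hy => by
      by_cases hyK : y ∈ K
      · nlinarith [hM y hyK, le_abs_self M, norm_nonneg x]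
      · have hy' : ‖fderiv ℝ f y‖ ≤ ε / 2 * ‖y‖ := hKc hyK
        nlinarith [norm_nonneg x]
  simpa [sq, mul_assoc] using this

end MeanValue

theorem ContinuousLinearMap.norm_le_abs_add_abs_of_prod (L : ℝ × ℝ →L[ℝ] ℝ) :
    ‖L‖ ≤ |L (1, 0)| + |L (0, 1)| := by
  refine L.opNorm_le_bound (by positivity) fun p => ?_
  have hp : L p = p.1 * L (1, 0) + p.2 * L (0, 1) := by
    have : p = p.1 • ((1, 0) : ℝ × ℝ) + p.2 • ((0, 1) : ℝ × ℝ) := by ext <;> simp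
    conv_lhs => rw [this, map_add, map_smul, map_smul]
    simp
  rw [hp, add_mul]
  refine (norm_add_le _ _).trans (add_le_add ?_ ?_)
  · rw [norm_mul, mul_comm]
    exact mul_le_mul_of_nonneg_left (_root_.norm_fst_le p) (norm_nonneg _)
  · rw [norm_mul, mul_comm]
    exact mul_le_mul_of_nonneg_left (_root_.norm_snd_le p) (norm_nonneg _)

theorem isLittleO_id_of_tendsto_div_abs_add_abs {g : ℝ × ℝ → ℝ} {l : Filter (ℝ × ℝ)}
    (hl : ∀ᶠ p in l, p ≠ 0) (h : Tendsto (fun p => g p / (|p.1| + |p.2|)) l (𝓝 0)) :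
    g =o[l] (id : ℝ × ℝ → ℝ × ℝ) := by
  have hg : g =o[l] fun p : ℝ × ℝ => |p.1| + |p.2| := by
    refine (isLittleO_iff_tendsto' ?_).2 h
    filter_upwards [hl] with p hp h0
    have h1 := abs_nonneg p.1
    have h2 := abs_nonneg p.2
    exact absurd (Prod.ext (abs_eq_zero.1 (by linarith)) (abs_eq_zero.1 (by linarith))) hp
  refine hg.trans_isBigO (IsBigO.of_bound 2 (Eventually.of_forall fun p => ?_))
  have h1 : |p.1| ≤ ‖p‖ := norm_fst_le p
  have h2 : |p.2| ≤ ‖p‖ := norm_snd_le p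
  rw [Real.norm_of_nonneg (by positivity), id]
  linarith

theorem fderiv_isLittleO_id_of_partials {f : ℝ × ℝ → ℝ} {l : Filter (ℝ × ℝ)}
    (h₁ : (fun p => fderiv ℝ f p (1, 0)) =o[l] (id : ℝ × ℝ → ℝ × ℝ))
    (h₂ : (fun p => fderiv ℝ f p (0, 1)) =o[l] (id : ℝ × ℝ → ℝ × ℝ)) :
    fderiv ℝ f =o[l] (id : ℝ × ℝ → ℝ × ℝ) := by
  refine IsBigO.trans_isLittleO (IsBigO.of_bound 1 (Eventually.of_forall fun p => ?_))
    (h₁.norm_left.add h₂.norm_left)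
  rw [one_mul]
  exact (fderiv ℝ f p).norm_le_abs_add_abs_of_prod.trans (le_abs_self _)

theorem norm_sq_isBigO_quadratic {α β : ℝ} (hα : 0 < α) (hβ : 0 < β) (l : Filter (ℝ × ℝ)) :
    (fun p : ℝ × ℝ => ‖p‖ ^ 2) =O[l] fun p => α * p.1 ^ 2 + β * p.2 ^ 2 := by
  refine IsBigO.of_bound (α⁻¹ + β⁻¹) (Eventually.of_forall fun p => ?_)
  have h1 : 0 ≤ α * p.1 ^ 2 := by positivity
  have h2 : 0 ≤ β * p.2 ^ 2 := by positivity
  rw [Real.norm_of_nonneg (by positivity), Real.norm_of_nonneg (by positivity)]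
  have hα' : α⁻¹ * (α * p.1 ^ 2) = p.1 ^ 2 := inv_mul_cancel_left₀ hα.ne' _
  have hβ' : β⁻¹ * (β * p.2 ^ 2) = p.2 ^ 2 := inv_mul_cancel_left₀ hβ.ne' _
  have h3 := mul_nonneg (inv_pos.2 hα).le h2
  have h4 := mul_nonneg (inv_pos.2 hβ).le h1
  rcases max_choice ‖p.1‖ ‖p.2‖ with h | h <;>
  · rw [Prod.norm_def, h, Real.norm_eq_abs, sq_abs]
    nlinarith [sq_nonneg p.1, sq_nonneg p.2]

theorem quadratic_pos {α β : ℝ} (hα : 0 < α) (hβ : 0 < β) {p : ℝ × ℝ} (hp : p ≠ 0) :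
    0 < α * p.1 ^ 2 + β * p.2 ^ 2 := by
  by_cases h : p.1 = 0
  · have : p.2 ≠ 0 := fun h' => hp (Prod.ext h h')
    positivity
  · positivity

/-- the supremum of F(s,t)/(αs²+βt²) is finite, positive and attained. -/
theorem stmt_5
    (F Fs Ft : ℝ × ℝ → ℝ)
    (hF : ContDiff ℝ 1 F)
    (hFs : ∀ p : ℝ × ℝ, Fs p = fderiv ℝ F p (1, 0))
    (hFt : ∀ p : ℝ × ℝ, Ft p = fderiv ℝ F p (0, 1))
    (hFpos : ∀ p : ℝ × ℝ, 0 ≤ F p)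
    (hF00 : F (0, 0) = 0)
    (hFne : F ≠ 0)
    (hFs0 : Filter.Tendsto (fun p : ℝ × ℝ => Fs p / (|p.1| + |p.2|))
      (nhdsWithin ((0, 0) : ℝ × ℝ) {((0, 0) : ℝ × ℝ)}ᶜ) (nhds 0))
    (hFt0 : Filter.Tendsto (fun p : ℝ × ℝ => Ft p / (|p.1| + |p.2|))
      (nhdsWithin ((0, 0) : ℝ × ℝ) {((0, 0) : ℝ × ℝ)}ᶜ) (nhds 0))
    (hFsInf : Filter.Tendsto (fun p : ℝ × ℝ => Fs p / (|p.1| + |p.2|))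
      (Filter.comap (fun p : ℝ × ℝ => |p.1| + |p.2|) Filter.atTop) (nhds 0))
    (hFtInf : Filter.Tendsto (fun p : ℝ × ℝ => Ft p / (|p.1| + |p.2|))
      (Filter.comap (fun p : ℝ × ℝ => |p.1| + |p.2|) Filter.atTop) (nhds 0))
    (α β : ℝ) (hα : 0 < α) (hβ : 0 < β)
    :
    ∃ p₀ : ℝ × ℝ, p₀ ≠ (0, 0) ∧
      0 < F p₀ / (α * p₀.1 ^ 2 + β * p₀.2 ^ 2) ∧
      ∀ p : ℝ × ℝ, p ≠ (0, 0) →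
        F p / (α * p.1 ^ 2 + β * p.2 ^ 2) ≤ F p₀ / (α * p₀.1 ^ 2 + β * p₀.2 ^ 2) := by
  set Q : ℝ × ℝ → ℝ := fun p => F p / (α * p.1 ^ 2 + β * p.2 ^ 2) with hQ
  have hF0 : F 0 = 0 := hF00
  have hdiff : Differentiable ℝ F := hF.differentiable one_ne_zero
  obtain rfl : Fs = fun p => fderiv ℝ F p (1, 0) := funext hFs
  obtain rfl : Ft = fun p => fderiv ℝ F p (0, 1) := funext hFt
  have hnhds : F =o[𝓝 0] fun p => ‖p‖ ^ 2 := by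
    refine isLittleO_norm_sq_nhds_zero_of_fderiv hdiff hF0 ?_
    have hmin : fderiv ℝ F 0 = 0 :=
      IsLocalMin.fderiv_eq_zero (Eventually.of_forall fun p => hF0 ▸ hFpos p)
    have hne : ∀ᶠ p : ℝ × ℝ in 𝓝[≠] 0, p ≠ 0 := self_mem_nhdsWithin
    have h := fderiv_isLittleO_id_of_partials
      (isLittleO_id_of_tendsto_div_abs_add_abs hne hFs0)
      (isLittleO_id_of_tendsto_div_abs_add_abs hne hFt0)
    rw [← nhdsNE_sup_pure]
    exact h.sup (isLittleO_pure.2 hmin)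
  have hcoc : F =o[cocompact (ℝ × ℝ)] fun p => ‖p‖ ^ 2 := by
    refine isLittleO_norm_sq_cocompact_of_fderiv hF hF0 ?_
    have hle : cocompact (ℝ × ℝ) ≤ comap (fun p : ℝ × ℝ => |p.1| + |p.2|) atTop := by
      refine tendsto_iff_comap.1 (tendsto_atTop_mono (fun p => ?_) tendsto_norm_cocompact_atTop)
      exact max_le (le_add_of_nonneg_right (abs_nonneg _)) (le_add_of_nonneg_left (abs_nonneg _))
    have hne : ∀ᶠ p : ℝ × ℝ in cocompact (ℝ × ℝ), p ≠ 0 :=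
      isCompact_singleton.compl_mem_cocompact
    exact fderiv_isLittleO_id_of_partials
      (isLittleO_id_of_tendsto_div_abs_add_abs hne (hFsInf.mono_left hle))
      (isLittleO_id_of_tendsto_div_abs_add_abs hne (hFtInf.mono_left hle))
  have hQ0 : Q 0 = 0 := by simp [hQ]
  have hQcont : Continuous Q := by
    refine continuous_iff_continuousAt.2 fun p => ?_
    by_cases hp : p = 0
    · subst hp
      rw [ContinuousAt, hQ0]
      exact (hnhds.trans_isBigO (norm_sq_isBigO_quadratic hα hβ _)).tendsto_div_nhds_zero
    · exact hF.continuous.continuousAt.div (by fun_prop) (quadratic_pos hα hβ hp).ne'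
  have hQcoc : Tendsto Q (cocompact (ℝ × ℝ)) (𝓝 0) :=
    (hcoc.trans_isBigO (norm_sq_isBigO_quadratic hα hβ _)).tendsto_div_nhds_zero
  obtain ⟨p₁, hp₁⟩ := Function.ne_iff.1 hFne
  have hp₁0 : p₁ ≠ 0 := fun h => hp₁ (h ▸ hF0)
  have hQp₁ : 0 < Q p₁ := div_pos ((hFpos p₁).lt_of_ne' hp₁) (quadratic_pos hα hβ hp₁0)
  obtain ⟨p₀, hp₀⟩ := hQcont.exists_forall_ge' p₁ (hQcoc.eventually_le_const hQp₁)
  have hQp₀ : 0 < Q p₀ := hQp₁.trans_le (hp₀ p₁)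
  exact ⟨p₀, fun h => hQp₀.ne' (h ▸ hQ0), hQp₀, fun p _ => hp₀ p⟩
end
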